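/- arXiv:1008.3579 — 4 statements merged into one kernel-verified Lean document; each statement's English description precedes it below -/
import Mathlib

section
/- Let n ≥ 2 and for a prime p and k ≥ 1 write G_k = SL_n(ℤ/p^kℤ), Z(G_k) for its center, and G_k^i = ker(SL_n(ℤ/p^kℤ) → SL_n(ℤ/p^iℤ)) for 0 ≤ i ≤ k. There exists a prime p₀ (depending only on n) such that for every prime p ≥ p₀ and every k ≥ 1, every normal subgroup N of G_k containing Z(G_k) is of the form N = G_k^i · Z(G_k) for some i with 0 ≤ i ≤ k. (Proposition 3.10 instantiated at the simply-connected Chevalley group SL_n.) -/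
open scoped Pointwise

/-- Entrywise reduction `SL_n(ℤ/bℤ) → SL_n(ℤ/aℤ)` for `a ∣ b`. -/
def slRed (n : ℕ) {a b : ℕ} (h : a ∣ b) :
    Matrix.SpecialLinearGroup (Fin n) (ZMod b) →* Matrix.SpecialLinearGroup (Fin n) (ZMod a) :=
  Matrix.SpecialLinearGroup.map (ZMod.castHom h (ZMod a))

/-- The congruence filtration subgroup `G_k^i = ker(SL_n(ℤ/p^kℤ) → SL_n(ℤ/p^iℤ))`. -/
abbrev slCongKer (n p k i : ℕ) (h : i ≤ k) :
    Subgroup (Matrix.SpecialLinearGroup (Fin n) (ZMod (p ^ k))) :=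
  (slRed n (pow_dvd_pow p h)).ker

section CongruenceSubgroups

open Matrix Matrix.SpecialLinearGroup

section Generation

variable {ι F : Type*} [Fintype ι] [DecidableEq ι] [Field F]

lemma diag2n_eq_prod_transvection {i j : ι} (hij : i ≠ j) (a : F) (ha : a ≠ 0) :
    diag2n hij a ha =
      Matrix.SpecialLinearGroup.transvection hij a *
      Matrix.SpecialLinearGroup.transvection hij.symm (-a⁻¹) *
      Matrix.SpecialLinearGroup.transvection hij a *
      Matrix.SpecialLinearGroup.transvection hij (-1) *
      Matrix.SpecialLinearGroup.transvection hij.symm 1 *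
      Matrix.SpecialLinearGroup.transvection hij (-1) := by
  have hd : (diag2n hij a ha : Matrix ι ι F) =
      1 + single i i (a - 1) + single j j (a⁻¹ - 1) := by
    ext x y
    by_cases hx : x = i <;> by_cases hy : x = j <;> by_cases hxy : x = y <;>
      simp_all [diag2n_coe, single_apply, one_apply] <;> grind
  apply Subtype.ext
  simp only [coe_mul, hd, transvection_coe, mul_add, add_mul, mul_one, one_mul,
    single_mul_single_same, single_mul_single_of_ne _ _ _ _ hij,
    single_mul_single_of_ne _ _ _ _ hij.symm, add_zero]
  ext x y
  simp only [Matrix.add_apply, single_apply]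
  split_ifs <;> field_simp <;> ring_nf

/-- Over a field, a property of `SL` that is multiplicative and holds for transvections
holds everywhere. -/
theorem SL_transvection_induction [Nontrivial ι] (P : SpecialLinearGroup ι F → Prop)
    (htransvec : ∀ (i j : ι) (h : i ≠ j) (c : F), P (Matrix.SpecialLinearGroup.transvection h c))
    (hmul : ∀ A B, P A → P B → P (A * B)) (A : SpecialLinearGroup ι F) : P A := by
  refine diagonal_transvection_induction' P _ (fun i j hij c hc ↦ ?_) htransvec hmul
  rw [diag2n_eq_prod_transvection hij c hc]
  refine hmul _ _ (hmul _ _ (hmul _ _ (hmul _ _ (hmul _ _ ?_ ?_) ?_) ?_) ?_) ?_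
  all_goals exact htransvec _ _ _ _

/-- A surjective ring homomorphism onto a field induces a surjection on `SL`. -/
theorem SL_map_surjective [Nontrivial ι] {R : Type*} [CommRing R] {f : R →+* F}
    (hf : Function.Surjective f) :
    Function.Surjective (SpecialLinearGroup.map (n := ι) f) := by
  intro A
  refine SL_transvection_induction (fun A ↦ ∃ B, SpecialLinearGroup.map f B = A) ?_ ?_ A
  · intro i j h c
    obtain ⟨r, rfl⟩ := hf c
    refine ⟨Matrix.SpecialLinearGroup.transvection h r, Subtype.ext ?_⟩
    change (1 + single i j r).map f = 1 + single i j (f r)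
    simp [Matrix.map_add]
  · rintro _ _ ⟨A, rfl⟩ ⟨B, rfl⟩
    exact ⟨A * B, map_mul _ _ _⟩

open scoped commutatorElement in
lemma commutator_diag2n_transvection {i j : ι} (hij : i ≠ j) (a : F) (ha : a ≠ 0) (b : F) :
    ⁅diag2n hij a ha, Matrix.SpecialLinearGroup.transvection hij b⁆ =
      Matrix.SpecialLinearGroup.transvection hij (b * (a ^ 2 - 1)) := by
  rw [commutatorElement_def, mul_inv_eq_iff_eq_mul, mul_inv_eq_iff_eq_mul, ← transvection_add]
  apply Subtype.ext
  ext x y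
  simp only [coe_mul, transvection_coe, diag2n_coe, diagonal_mul, mul_diagonal, Matrix.add_apply,
    one_apply, single_apply]
  grind

theorem SL_commutator_eq_top [Nontrivial ι] {a : F} (ha : a ≠ 0) (hasq : a ^ 2 ≠ 1) :
    commutator (SpecialLinearGroup ι F) = ⊤ := by
  refine eq_top_iff.2 fun A _ ↦
    SL_transvection_induction (· ∈ commutator (SpecialLinearGroup ι F)) (fun i j h c ↦ ?_)
      (fun _ _ ↦ mul_mem) A
  have h := commutator_diag2n_transvection h a ha (c / (a ^ 2 - 1))
  rw [div_mul_cancel₀ c (sub_ne_zero_of_ne hasq)] at h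
  rw [← h]
  exact Subgroup.commutator_mem_commutator (Subgroup.mem_top _) (Subgroup.mem_top _)

open scoped LinearAlgebra.Projectivization in
/-- The Iwasawa structure of `SL` acting on projective space. -/
noncomputable def SLIwasawa [Nontrivial ι] :
    MulAction.IwasawaStructure (SpecialLinearGroup ι F) (ℙ F (ι → F)) where
  T x := lineStab x.submodule
  is_comm x := by
    induction x using Projectivization.ind with | _ v hv => ?_
    rw [Projectivization.submodule_mk]
    exact lineStab_isMulCommutative_of_span v hv
  is_conj g x := by rw [PSL.smul_submodule, lineStab_smul]
  is_generator := by
    refine eq_top_iff.2 fun A _ ↦ SL_transvection_induction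
      (· ∈ ⨆ x : ℙ F (ι → F), lineStab x.submodule) (fun i j h c ↦ ?_) (fun _ _ ↦ mul_mem) A
    refine Subgroup.mem_iSup_of_mem
      (Projectivization.mk F (Pi.single i (1 : F) : ι → F) (by simp)) ?_
    rw [Projectivization.submodule_mk]
    exact fun w ↦ Submodule.mem_span_singleton.2 ⟨c * w j, by
      simp [mul_smul, Matrix.SpecialLinearGroup.smul_def, transvection_coe, add_smul,
        Matrix.single_mulVec_eq]⟩

/-- A noncentral normal subgroup of `SL` over a field with an element `a ≠ 0`, `a ^ 2 ≠ 1`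
is everything. -/
theorem SL_normal_eq_top [Nontrivial ι] {a : F} (ha : a ≠ 0) (hasq : a ^ 2 ≠ 1)
    (N : Subgroup (SpecialLinearGroup ι F)) [N.Normal]
    (hN : ¬ N ≤ Subgroup.center (SpecialLinearGroup ι F)) : N = ⊤ := by
  rw [eq_top_iff, ← SL_commutator_eq_top ha hasq]
  refine SLIwasawa.commutator_le N fun h ↦ hN fun g hg ↦ ?_
  rw [← Projectivization.SL_mulAction_ker, MonoidHom.mem_ker]
  ext x
  exact Set.eq_univ_iff_forall.mp h x ⟨g, hg⟩

end Generation

section Adjoint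

variable {ι F : Type*} [Fintype ι] [DecidableEq ι] [Field F]

/-- A subspace of matrices is invariant under conjugation by transvections. -/
def TransvectionInvariant (L : Submodule F (Matrix ι ι F)) : Prop :=
  ∀ (i j : ι), i ≠ j → ∀ c : F, ∀ X ∈ L, (1 + single i j c) * X * (1 + single i j (-c)) ∈ L

namespace TransvectionInvariant

variable {L : Submodule F (Matrix ι ι F)}

lemma single_mem_of_apply_ne_zero (hL : TransvectionInvariant L)
    (h2 : (2 : F) ≠ 0) {X : Matrix ι ι F} (hX : X ∈ L) {i j : ι}
    (hij : i ≠ j) (h : X j i ≠ 0) : single i j 1 ∈ L := by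
  have h1 := L.sub_mem (L.add_mem (hL i j hij 1 X hX) (hL i j hij (-1) X hX))
    (L.smul_mem 2 hX)
  have key : (1 + single i j 1) * X * (1 + single i j (-1)) +
      (1 + single i j (-1)) * X * (1 + single i j (- -1)) - (2 : F) • X =
      (-2 * X j i) • single i j (1 : F) := by
    have hE : single i j (1 : F) * X * single i j 1 = X j i • single i j 1 := by
      ext x y
      simp [single_mul_mul_single, single_apply]
    rw [neg_neg, ← single_neg, mul_smul, ← hE, two_smul, neg_smul, two_smul]
    noncomm_ring
  rw [key] at h1
  exact (L.smul_mem_iff (mul_ne_zero (neg_ne_zero.2 h2) h)).1 h1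

lemma single_sub_single_mem (hL : TransvectionInvariant L)
    (h2 : (2 : F) ≠ 0) {i j : ι} (hij : i ≠ j)
    (h : single i j (1 : F) ∈ L) : single j j (1 : F) - single i i 1 ∈ L := by
  have h' : single j i (1 : F) ∈ L := hL.single_mem_of_apply_ne_zero h2 h hij.symm (by simp)
  have h1 := L.add_mem (L.sub_mem (hL j i hij.symm 1 _ h) h) h'
  convert h1 using 1
  simp [mul_add, add_mul, ← single_neg]
  abel

lemma single_mem_of_single_mem (hL : TransvectionInvariant L)
    (h2 : (2 : F) ≠ 0) {i j : ι} (hij : i ≠ j)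
    (h : single i j (1 : F) ∈ L) {k l : ι} (hkl : k ≠ l) : single k l (1 : F) ∈ L := by
  have row {i j : ι} (hij : i ≠ j) (h : single i j (1 : F) ∈ L) (k : ι) (hk : k ≠ j) :
      single k j (1 : F) ∈ L := by
    obtain rfl | hki := eq_or_ne k i
    · exact h
    convert L.sub_mem (hL k i hki 1 _ h) h using 1
    simp [mul_add, add_mul, hk.symm]
  have col {i j : ι} (hij : i ≠ j) (h : single i j (1 : F) ∈ L) (l : ι) (hl : i ≠ l) :
      single i l (1 : F) ∈ L := by
    obtain rfl | hlj := eq_or_ne j l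
    · exact h
    convert L.sub_mem (hL j l hlj (-1) _ h) h using 1
    simp [mul_add, add_mul, hl.symm]
  by_cases hkj : k = j
  · subst hkj
    exact col hij.symm (hL.single_mem_of_apply_ne_zero h2 h hij.symm (by simp)) l hkl
  · exact col hkj (row hij h k hkj) l hkl

/-- In characteristic not two, a subspace of matrices that is invariant under conjugation by
transvections and contains a nonscalar matrix contains all matrices of trace zero. -/
theorem mem_of_trace_eq_zero (hL : TransvectionInvariant L)
    (h2 : (2 : F) ≠ 0) {X : Matrix ι ι F} (hX : X ∈ L)
    (hs : ∀ c, X ≠ scalar ι c) {Y : Matrix ι ι F} (hY : Y.trace = 0) : Y ∈ L := by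
  obtain ⟨i, j, hij, hE⟩ : ∃ i j : ι, i ≠ j ∧ single i j (1 : F) ∈ L := by
    by_cases hoff : ∃ i j, i ≠ j ∧ X j i ≠ 0
    · obtain ⟨i, j, hij, h⟩ := hoff
      exact ⟨i, j, hij, hL.single_mem_of_apply_ne_zero h2 hX hij h⟩
    push Not at hoff
    obtain ⟨i, j, hd⟩ : ∃ i j, X i i ≠ X j j := by
      by_contra! hd
      rcases isEmpty_or_nonempty ι with hι | ⟨⟨o⟩⟩
      · exact hs 0 (Subsingleton.elim _ _)
      · refine hs (X o o) ?_
        ext x y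
        obtain rfl | hxy := eq_or_ne x y
        · simp [hd x o]
        · simp [hxy, hoff y x hxy.symm]
    have hij : i ≠ j := fun h ↦ hd (h ▸ rfl)
    refine ⟨j, i, hij.symm, hL.single_mem_of_apply_ne_zero h2 (hL i j hij 1 X hX) hij.symm ?_⟩
    simp [mul_add, add_mul, hoff j i hij.symm, hoff i j hij]
    grind
  rcases isEmpty_or_nonempty ι with hι | ⟨⟨o⟩⟩
  · rw [Subsingleton.elim Y 0]; exact L.zero_mem
  have hdec : Y = ∑ x, ∑ y, Y x y • (single x y (1 : F) - if x = y then single o o 1 else 0) := by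
    have : Y = (∑ x, ∑ y, Y x y • single x y (1 : F)) - Y.trace • single o o (1 : F) := by
      rw [hY, zero_smul, sub_zero]
      nth_rw 1 [matrix_eq_sum_single Y]
      simp
    nth_rw 1 [this]
    simp [smul_sub, Finset.sum_sub_distrib, trace, Finset.sum_smul]
  rw [hdec]
  refine L.sum_mem fun x _ ↦ L.sum_mem fun y _ ↦ L.smul_mem _ ?_
  obtain rfl | hxy := eq_or_ne x y
  · obtain rfl | hxo := eq_or_ne x o
    · simp
    · simpa using hL.single_sub_single_mem h2 hxo.symm (hL.single_mem_of_single_mem h2 hij hE hxo.symm)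
  · simpa [hxy] using hL.single_mem_of_single_mem h2 hij hE hxy

end TransvectionInvariant

end Adjoint

section Layers

variable {ι R S : Type*} [Fintype ι] [DecidableEq ι] [CommRing R] [CommRing S]

lemma mapMatrix_coe_inv (ρ : R →+* S) {y : SpecialLinearGroup ι R}
    (hy : ρ.mapMatrix (y : Matrix ι ι R) = 1) :
    ρ.mapMatrix ((y⁻¹ : SpecialLinearGroup ι R) : Matrix ι ι R) = 1 := by
  have h : SpecialLinearGroup.map ρ y = 1 := Subtype.ext hy
  exact congrArg Subtype.val (show SpecialLinearGroup.map ρ y⁻¹ = 1 by rw [map_inv, h, inv_one])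

lemma mapMatrix_one_add_smul (ρ : R →+* S) {π : R} (hπ : ρ π = 0) {j : ℕ} (hj : j ≠ 0)
    (X : Matrix ι ι R) : ρ.mapMatrix (1 + π ^ j • X) = 1 := by
  ext a b
  simp [hπ, hj, one_apply, apply_ite ρ]

/-- The set of leading coefficients, reduced along `ρ`, of the elements `1 + π ^ j • X` of a
subgroup `N` of `SL`. -/
def layer (ρ : R →+* S) (π : R) (N : Subgroup (SpecialLinearGroup ι R)) (j : ℕ) :
    Set (Matrix ι ι S) :=
  {Y | ∃ X, ρ.mapMatrix X = Y ∧ ∃ y ∈ N, (y : Matrix ι ι R) = 1 + π ^ j • X}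

/-- `layer` as an additive subgroup, in positive degree. -/
def layerAddSubgroup (ρ : R →+* S) {π : R} (hπ : ρ π = 0)
    (N : Subgroup (SpecialLinearGroup ι R)) {j : ℕ} (hj : j ≠ 0) :
    AddSubgroup (Matrix ι ι S) where
  carrier := layer ρ π N j
  zero_mem' := ⟨0, by simp, 1, N.one_mem, by simp⟩
  add_mem' := by
    rintro _ _ ⟨X, rfl, x, hx, hxX⟩ ⟨Y, rfl, y, hy, hyY⟩
    refine ⟨X + Y * x, ?_, y * x, N.mul_mem hy hx, ?_⟩
    · rw [map_add, map_mul, hxX, mapMatrix_one_add_smul ρ hπ hj, mul_one]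
    · rw [coe_mul, hyY, add_mul, hxX]
      simp only [one_mul, smul_mul_assoc, smul_add, add_assoc]
  neg_mem' := by
    rintro _ ⟨X, rfl, x, hx, hxX⟩
    have h1 : ρ.mapMatrix (x : Matrix ι ι R) = 1 := by rw [hxX, mapMatrix_one_add_smul ρ hπ hj]
    refine ⟨-(X * (x⁻¹ : SpecialLinearGroup ι R)), ?_, x⁻¹, N.inv_mem hx, ?_⟩
    · rw [map_neg, map_mul, mapMatrix_coe_inv ρ h1, mul_one]
    · have h : (x : Matrix ι ι R) * (x⁻¹ : SpecialLinearGroup ι R) = 1 := by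
        rw [← coe_mul, mul_inv_cancel, coe_one]
      have h' : (1 + π ^ j • X) * ((x⁻¹ : SpecialLinearGroup ι R) : Matrix ι ι R) = 1 := hxX ▸ h
      rw [smul_neg, ← smul_mul_assoc, ← sub_eq_add_neg, eq_sub_iff_add_eq]
      rwa [add_mul, one_mul] at h'

lemma conj_mem_layer (ρ : R →+* S) {π : R} {N : Subgroup (SpecialLinearGroup ι R)} [hN : N.Normal]
    {j : ℕ} {Y : Matrix ι ι S} (hY : Y ∈ layer ρ π N j) (g : SpecialLinearGroup ι R) :
    ρ.mapMatrix (g : Matrix ι ι R) * Y *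
      ρ.mapMatrix ((g⁻¹ : SpecialLinearGroup ι R) : Matrix ι ι R) ∈ layer ρ π N j := by
  obtain ⟨X, rfl, y, hy, hyX⟩ := hY
  refine ⟨g * X * (g⁻¹ : SpecialLinearGroup ι R), by simp only [map_mul], g * y * g⁻¹,
    hN.conj_mem y hy g, ?_⟩
  have h : (g : Matrix ι ι R) * (g⁻¹ : SpecialLinearGroup ι R) = 1 := by
    rw [← coe_mul, mul_inv_cancel, coe_one]
  rw [coe_mul, coe_mul, hyX, mul_add, add_mul, mul_one, h, mul_smul_comm, smul_mul_assoc]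

lemma commutator_mem_layer (ρ : R →+* S) {π : R} {N : Subgroup (SpecialLinearGroup ι R)}
    [hN : N.Normal] {j : ℕ} {y : SpecialLinearGroup ι R} (hy : y ∈ N)
    (g : SpecialLinearGroup ι R) {C : Matrix ι ι R}
    (hC : (g : Matrix ι ι R) * (y : Matrix ι ι R) - (y : Matrix ι ι R) * (g : Matrix ι ι R) =
      π ^ j • C) :
    ρ.mapMatrix (C * (((y * g)⁻¹ : SpecialLinearGroup ι R) : Matrix ι ι R)) ∈ layer ρ π N j := by
  refine ⟨_, rfl, g * y * g⁻¹ * y⁻¹, N.mul_mem (hN.conj_mem y hy g) (N.inv_mem hy), ?_⟩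
  have h : ((y * g : SpecialLinearGroup ι R) : Matrix ι ι R) *
      (((y * g)⁻¹ : SpecialLinearGroup ι R) : Matrix ι ι R) = 1 := by
    rw [← coe_mul, mul_inv_cancel, coe_one]
  rw [← smul_mul_assoc, ← hC, sub_mul, ← coe_mul y g, h, mul_assoc, ← _root_.mul_inv_rev, ← coe_mul g y,
    ← coe_mul, add_sub_cancel]

variable {p : ℕ} [Fact p.Prime]

lemma layer_of_nonscalar (h2 : (2 : ZMod p) ≠ 0) {ρ : R →+* ZMod p}
    (hρ : Function.Surjective ρ) {π : R} (hπ : ρ π = 0)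
    {N : Subgroup (SpecialLinearGroup ι R)} [N.Normal] {j : ℕ} (hj : j ≠ 0)
    {X : Matrix ι ι (ZMod p)} (hX : X ∈ layer ρ π N j) (hs : ∀ c, X ≠ scalar ι c)
    {Y : Matrix ι ι (ZMod p)} (hY : Y.trace = 0) : Y ∈ layer ρ π N j := by
  let L : Submodule (ZMod p) (Matrix ι ι (ZMod p)) :=
    AddSubgroup.toZModSubmodule p (layerAddSubgroup ρ hπ N hj)
  have hL : TransvectionInvariant L := by
    intro a b hab c Z hZ
    obtain ⟨r, rfl⟩ := hρ c
    have h := conj_mem_layer ρ (N := N) hZ (Matrix.SpecialLinearGroup.transvection hab r)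
    have key (s : R) : ρ.mapMatrix (Matrix.SpecialLinearGroup.transvection hab s : Matrix ι ι R) =
        1 + single a b (ρ s) := by
      rw [transvection_coe, map_add, map_one]
      simp
    rwa [transvection_inv, key, key, map_neg] at h
  exact hL.mem_of_trace_eq_zero h2 (X := X) hX hs hY

lemma single_sub_single_add_ne_scalar (h2 : (2 : ZMod p) ≠ 0) {a b : ι} (hab : a ≠ b)
    (d c : ZMod p) :
    single b b (1 : ZMod p) - single a a 1 + single a b d ≠ scalar ι c := by
  intro h
  have h1 := congrFun (congrFun h a) a
  have h3 := congrFun (congrFun h b) b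
  simp [hab, hab.symm] at h1 h3
  apply h2
  grind

lemma layer_succ (h2 : (2 : ZMod p) ≠ 0) [Nontrivial ι] {ρ : R →+* ZMod p}
    (hρ : Function.Surjective ρ) {π : R} (hπ : ρ π = 0)
    {N : Subgroup (SpecialLinearGroup ι R)} [N.Normal] {j : ℕ} (hj : j ≠ 0)
    (h : ∀ Y : Matrix ι ι (ZMod p), Y.trace = 0 → Y ∈ layer ρ π N j)
    {Y : Matrix ι ι (ZMod p)} (hY : Y.trace = 0) : Y ∈ layer ρ π N (j + 1) := by
  obtain ⟨a, b, hab⟩ := exists_pair_ne ι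
  obtain ⟨X, hX, y, hy, hyX⟩ := h (single a b 1) (by simp [hab])
  have hC : ((Matrix.SpecialLinearGroup.transvection hab.symm π :
      SpecialLinearGroup ι R) : Matrix ι ι R) * (y : Matrix ι ι R) -
      (y : Matrix ι ι R) * ((Matrix.SpecialLinearGroup.transvection hab.symm π :
        SpecialLinearGroup ι R) : Matrix ι ι R) =
      π ^ (j + 1) • (single b a 1 * X - X * single b a 1) := by
    have hs : single b a π = π • single b a (1 : R) := by simp
    rw [transvection_coe, hyX, hs]
    simp only [mul_add, add_mul, mul_one, one_mul, smul_mul_assoc, mul_smul_comm]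
    module
  have hmem := commutator_mem_layer ρ hy _ hC
  refine layer_of_nonscalar h2 hρ hπ j.succ_ne_zero hmem (fun c hc ↦ ?_) hY
  refine single_sub_single_add_ne_scalar h2 hab 0 c ?_
  rw [← hc, map_mul, mapMatrix_coe_inv, mul_one, map_sub, map_mul, map_mul, hX]
  · simp
  · rw [coe_mul, map_mul, hyX, mapMatrix_one_add_smul ρ hπ hj, one_mul, transvection_coe, map_add,
      map_one]
    simp [hπ]

lemma layer_one_of_surjective (h2 : (2 : ZMod p) ≠ 0) [Nontrivial ι] {ρ : R →+* ZMod p}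
    (hρ : Function.Surjective ρ) {π : R} (hπ : ρ π = 0)
    {N : Subgroup (SpecialLinearGroup ι R)} [N.Normal]
    (h : N.map (SpecialLinearGroup.map ρ) = ⊤)
    {Y : Matrix ι ι (ZMod p)} (hY : Y.trace = 0) : Y ∈ layer ρ π N 1 := by
  obtain ⟨a, b, hab⟩ := exists_pair_ne ι
  obtain ⟨y, hy, hyt⟩ : Matrix.SpecialLinearGroup.transvection hab (1 : ZMod p) ∈
    N.map (SpecialLinearGroup.map ρ) := h ▸ Subgroup.mem_top _
  have hC : ((Matrix.SpecialLinearGroup.transvection hab.symm π :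
      SpecialLinearGroup ι R) : Matrix ι ι R) * (y : Matrix ι ι R) -
      (y : Matrix ι ι R) * ((Matrix.SpecialLinearGroup.transvection hab.symm π :
        SpecialLinearGroup ι R) : Matrix ι ι R) =
      π ^ 1 • (single b a 1 * (y : Matrix ι ι R) - (y : Matrix ι ι R) * single b a 1) := by
    have hs : single b a π = π • single b a (1 : R) := by simp
    rw [transvection_coe, hs]
    simp only [mul_add, add_mul, mul_one, one_mul, smul_mul_assoc, mul_smul_comm, smul_sub,
      pow_one]
    abel
  have hmem := commutator_mem_layer ρ hy _ hC
  refine layer_of_nonscalar h2 hρ hπ one_ne_zero hmem (fun c hc ↦ ?_) hY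
  refine single_sub_single_add_ne_scalar h2 hab 1 c ?_
  have hyρ : ρ.mapMatrix (y : Matrix ι ι R) = 1 + single a b 1 := congrArg Subtype.val hyt
  have hg : SpecialLinearGroup.map ρ (Matrix.SpecialLinearGroup.transvection hab.symm π) = 1 := by
    apply Subtype.ext
    change ρ.mapMatrix (1 + single b a π) = 1
    rw [map_add, map_one]
    simp [hπ]
  have hinv : ρ.mapMatrix (((y * Matrix.SpecialLinearGroup.transvection hab.symm π)⁻¹ :
      SpecialLinearGroup ι R) : Matrix ι ι R) = 1 + single a b (-1) := by
    refine congrArg Subtype.val (show SpecialLinearGroup.map ρ _ =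
      Matrix.SpecialLinearGroup.transvection hab (-1 : ZMod p) from ?_)
    rw [map_inv, map_mul, hg, mul_one, hyt, transvection_inv]
  rw [← hc, map_mul, hinv, map_sub, map_mul, map_mul, hyρ]
  simp [mul_add, add_mul, sub_mul, hab.symm]
  simp [← single_neg]

end Layers

section TopDown

variable {ι R : Type*} [Fintype ι] [DecidableEq ι] [CommRing R] {p : ℕ} {k : ℕ} {π : R}
  {ρ : R →+* ZMod p}

lemma trace_map_eq_zero (hπ : ρ π = 0) {j : ℕ} (hj : j ≠ 0)
    (hreg : ∀ x, π ^ j * x = 0 → ρ x = 0) {g : SpecialLinearGroup ι R} {X : Matrix ι ι R}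
    (hg : (g : Matrix ι ι R) = 1 + π ^ j • X) : (ρ.mapMatrix X).trace = 0 := by
  have hdet : (1 + π ^ j • X).det = 1 := hg ▸ g.det_coe
  obtain ⟨w, hw⟩ : ∃ w, 1 + X.trace * π ^ j + w * (π ^ j) ^ 2 = 1 :=
    ⟨_, (det_one_add_smul (π ^ j) X).symm.trans hdet⟩
  have h := hreg (X.trace + w * π ^ j) (by linear_combination hw)
  rw [map_add, map_mul, map_pow, hπ, zero_pow hj, mul_zero, add_zero] at h
  rw [← h]
  simp [trace]

lemma mem_of_forall_layer (hπ : ρ π = 0) (hker : ∀ x, ρ x = 0 → π ∣ x) (hk : π ^ k = 0)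
    (hreg : ∀ j < k, ∀ x, π ^ j * x = 0 → ρ x = 0) {N : Subgroup (SpecialLinearGroup ι R)}
    {i : ℕ} (hi : i ≠ 0)
    (hN : ∀ j, i ≤ j → ∀ Y : Matrix ι ι (ZMod p), Y.trace = 0 → Y ∈ layer ρ π N j)
    {g : SpecialLinearGroup ι R} {X : Matrix ι ι R}
    (hg : (g : Matrix ι ι R) = 1 + π ^ i • X) : g ∈ N := by
  suffices H : ∀ m j, i ≤ j → k ≤ j + m → ∀ (g : SpecialLinearGroup ι R) (X : Matrix ι ι R),
      (g : Matrix ι ι R) = 1 + π ^ j • X → g ∈ N from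
    H k i le_rfl (Nat.le_add_left k i) g X hg
  intro m
  induction m with
  | zero =>
    intro j _ hkj g X hg
    rw [pow_eq_zero_of_le (by simpa using hkj) hk, zero_smul, add_zero] at hg
    rw [show g = 1 from Subtype.ext hg]
    exact N.one_mem
  | succ m ih =>
    intro j hij hkj g X hg
    rcases le_or_gt k j with h | hjk
    · exact ih j hij (by omega) g X hg
    have hj : j ≠ 0 := by omega
    obtain ⟨Y, hYX, y, hy, hyY⟩ := hN j hij _ (trace_map_eq_zero hπ hj (hreg j hjk) hg)
    have hdvd : ∀ a b, ∃ z, X a b - Y a b = π * z := fun a b ↦ by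
      refine hker _ ?_
      rw [map_sub, sub_eq_zero]
      exact (congrFun (congrFun hYX a) b).symm
    choose Z hZ using hdvd
    have hXY : X = Y + π • (Matrix.of Z) := by
      ext a b
      simp [← hZ]
    have hyinv : (y : Matrix ι ι R) * ((y⁻¹ : SpecialLinearGroup ι R) : Matrix ι ι R) = 1 := by
      rw [← coe_mul, mul_inv_cancel, coe_one]
    have hgy : g * y⁻¹ ∈ N := by
      refine ih (j + 1) (by omega) (by omega) _
        (Matrix.of Z * ((y⁻¹ : SpecialLinearGroup ι R) : Matrix ι ι R)) ?_
      have : (g : Matrix ι ι R) = y + π ^ (j + 1) • Matrix.of Z := by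
        rw [hg, hyY, hXY]
        module
      rw [coe_mul, this, add_mul, hyinv, smul_mul_assoc]
    simpa using N.mul_mem hgy hy

end TopDown

section Congruence

variable {n p k : ℕ}

lemma zmod_castHom_pow_eq_zero_iff {i : ℕ} (hi : i ≤ k) (x : ZMod (p ^ k)) [NeZero p] :
    ZMod.castHom (pow_dvd_pow p hi) (ZMod (p ^ i)) x = 0 ↔ (p : ZMod (p ^ k)) ^ i ∣ x := by
  constructor
  · intro h
    rw [← ZMod.natCast_zmod_val x, map_natCast, ZMod.natCast_eq_zero_iff] at h
    obtain ⟨c, hc⟩ := h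
    exact ⟨c, by rw [← ZMod.natCast_zmod_val x, hc]; push_cast; rfl⟩
  · rintro ⟨c, rfl⟩
    rw [map_mul, map_pow, map_natCast, ← Nat.cast_pow, ZMod.natCast_self, zero_mul]

lemma exists_coe_eq_one_add_smul {ι R S : Type*} [Fintype ι] [DecidableEq ι] [CommRing R]
    [CommRing S] {ρ : R →+* S} {q : R} (hker : ∀ x, ρ x = 0 → q ∣ x) {g : SpecialLinearGroup ι R}
    (hg : SpecialLinearGroup.map ρ g = 1) : ∃ X, (g : Matrix ι ι R) = 1 + q • X := by
  have hdvd : ∀ a b, ∃ z, (g : Matrix ι ι R) a b - (1 : Matrix ι ι R) a b = q * z := fun a b ↦ by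
    refine hker _ ?_
    rw [map_sub, sub_eq_zero]
    refine (congrFun (congrFun (congrArg Subtype.val hg) a) b).trans ?_
    change (1 : Matrix ι ι S) a b = _
    rw [one_apply, one_apply, apply_ite ρ, map_one, map_zero]
  choose X hX using hdvd
  refine ⟨Matrix.of X, ?_⟩
  ext a b
  simp [← hX]

lemma mem_slCongKer_iff [NeZero p] {i : ℕ} (hi : i ≤ k)
    (g : SpecialLinearGroup (Fin n) (ZMod (p ^ k))) :
    g ∈ slCongKer n p k i hi ↔ ∃ X : Matrix (Fin n) (Fin n) (ZMod (p ^ k)),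
      (g : Matrix (Fin n) (Fin n) (ZMod (p ^ k))) = 1 + (p : ZMod (p ^ k)) ^ i • X := by
  rw [MonoidHom.mem_ker]
  constructor
  · exact exists_coe_eq_one_add_smul fun x ↦ (zmod_castHom_pow_eq_zero_iff hi x).1
  · rintro ⟨X, hX⟩
    apply Subtype.ext
    change (ZMod.castHom (pow_dvd_pow p hi) (ZMod (p ^ i))).mapMatrix
      (g : Matrix (Fin n) (Fin n) (ZMod (p ^ k))) = 1
    rw [hX, map_add, map_one]
    ext a b
    simpa using (zmod_castHom_pow_eq_zero_iff hi _).2 (Dvd.intro (X a b) rfl)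

lemma slCongKer_self : slCongKer n p k k le_rfl = ⊥ := by
  rw [eq_bot_iff]
  intro g hg
  rw [MonoidHom.mem_ker] at hg
  apply Subtype.ext
  ext a b
  have := congrFun (congrFun (congrArg Subtype.val hg) a) b
  rw [← show _ = _ from this]
  change _ = ZMod.castHom (pow_dvd_pow p le_rfl) (ZMod (p ^ k)) _
  rw [ZMod.castHom_self]
  rfl

lemma slCongKer_zero : slCongKer n p k 0 k.zero_le = ⊤ := by
  rw [eq_top_iff]
  intro g _
  rw [MonoidHom.mem_ker]
  apply Subtype.ext
  ext a b
  have : Subsingleton (ZMod (p ^ 0)) := by rw [pow_zero]; infer_instance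
  exact Subsingleton.elim _ _

end Congruence

section PrimePower

variable {n p k : ℕ} [Fact p.Prime]

lemma zmod_castHom_prime_eq_zero (hk : k ≠ 0) (x : ZMod (p ^ k))
    (hx : ZMod.castHom (dvd_pow_self p hk) (ZMod p) x = 0) : (p : ZMod (p ^ k)) ∣ x := by
  rw [← ZMod.natCast_zmod_val x, map_natCast, ZMod.natCast_eq_zero_iff] at hx
  obtain ⟨c, hc⟩ := hx
  exact ⟨c, by rw [← ZMod.natCast_zmod_val x, hc]; push_cast; rfl⟩

lemma zmod_castHom_eq_zero_of_pow_mul_eq_zero (hk : k ≠ 0) {j : ℕ} (hj : j < k) (x : ZMod (p ^ k))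
    (hx : (p : ZMod (p ^ k)) ^ j * x = 0) :
    ZMod.castHom (dvd_pow_self p hk) (ZMod p) x = 0 := by
  have hp : 0 < p := (Fact.out : p.Prime).pos
  rw [← ZMod.natCast_zmod_val x, ← Nat.cast_pow, ← Nat.cast_mul, ZMod.natCast_eq_zero_iff] at hx
  rw [← ZMod.natCast_zmod_val x, map_natCast, ZMod.natCast_eq_zero_iff]
  refine Nat.dvd_of_mul_dvd_mul_left (pow_pos hp j) ?_
  rw [← pow_succ]
  exact (pow_dvd_pow p hj).trans hx

lemma zmod_exists_pow_eq_one_lift (hk : k ≠ 0) {r : ZMod p} (hr : r ^ n = 1) :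
    ∃ s : ZMod (p ^ k), s ^ n = 1 ∧ ZMod.castHom (dvd_pow_self p hk) (ZMod p) s = r := by
  obtain ⟨l, hl⟩ := ZMod.castHom_surjective (dvd_pow_self p hk) r
  refine ⟨l ^ p ^ (k - 1), ?_, by rw [map_pow, hl, ZMod.pow_card_pow]⟩
  have hdvd : (p : ZMod (p ^ k)) ∣ l ^ n - 1 := by
    apply zmod_castHom_prime_eq_zero hk
    rw [map_sub, map_pow, hl, hr, map_one, sub_self]
  have h := dvd_sub_pow_of_dvd_sub hdvd (k - 1)
  rw [Nat.sub_add_cancel (Nat.one_le_iff_ne_zero.2 hk), ← Nat.cast_pow, ZMod.natCast_self,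
    zero_dvd_iff, one_pow, sub_eq_zero] at h
  rw [← pow_mul, mul_comm, pow_mul, h]

variable {N : Subgroup (SpecialLinearGroup (Fin n) (ZMod (p ^ k)))} [N.Normal]

lemma slCongKer_le_of_layer [Nontrivial (Fin n)] (h2 : (2 : ZMod p) ≠ 0) (hk : k ≠ 0) {i : ℕ}
    (hi : i ≠ 0) (hik : i ≤ k)
    (h : ∀ Y : Matrix (Fin n) (Fin n) (ZMod p), Y.trace = 0 →
      Y ∈ layer (ZMod.castHom (dvd_pow_self p hk) (ZMod p)) (p : ZMod (p ^ k)) N i) :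
    slCongKer n p k i hik ≤ N := by
  intro g hg
  obtain ⟨X, hX⟩ := (mem_slCongKer_iff hik g).1 hg
  have hp0 : ZMod.castHom (dvd_pow_self p hk) (ZMod p) (p : ZMod (p ^ k)) = 0 := by simp
  refine mem_of_forall_layer hp0 (zmod_castHom_prime_eq_zero hk)
    (by rw [← Nat.cast_pow, ZMod.natCast_self])
    (fun j hj ↦ zmod_castHom_eq_zero_of_pow_mul_eq_zero hk hj) hi (fun j hj ↦ ?_) hX
  induction j, hj using Nat.le_induction with
  | base => exact h
  | succ j hj ih =>
    exact fun Y hY ↦ layer_succ h2 (ZMod.castHom_surjective _) hp0 (by omega) ih hY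

lemma exists_mul_center_of_map_le_center (hk : k ≠ 0)
    {g : SpecialLinearGroup (Fin n) (ZMod (p ^ k))}
    (hg : SpecialLinearGroup.map (ZMod.castHom (dvd_pow_self p hk) (ZMod p)) g ∈
      Subgroup.center (SpecialLinearGroup (Fin n) (ZMod p))) :
    ∃ z ∈ Subgroup.center (SpecialLinearGroup (Fin n) (ZMod (p ^ k))),
      SpecialLinearGroup.map (ZMod.castHom (dvd_pow_self p hk) (ZMod p)) (g * z⁻¹) = 1 := by
  obtain ⟨r, hr, hrg⟩ := Matrix.SpecialLinearGroup.mem_center_iff.1 hg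
  rw [Fintype.card_fin] at hr
  obtain ⟨s, hs, rfl⟩ := zmod_exists_pow_eq_one_lift hk hr
  let z : SpecialLinearGroup (Fin n) (ZMod (p ^ k)) := ⟨scalar (Fin n) s, by simp [hs]⟩
  refine ⟨z, Matrix.SpecialLinearGroup.mem_center_iff.2 ⟨s, by rwa [Fintype.card_fin], rfl⟩, ?_⟩
  rw [map_mul, map_inv, mul_inv_eq_one]
  apply Subtype.ext
  rw [← hrg]
  change _ = (ZMod.castHom (dvd_pow_self p hk) (ZMod p)).mapMatrix (scalar (Fin n) s)
  ext a b
  simp [diagonal_apply, apply_ite (ZMod.cast : ZMod (p ^ k) → ZMod p)]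

lemma eq_top_of_map_eq_top [Nontrivial (Fin n)] (h2 : (2 : ZMod p) ≠ 0) (hk : k ≠ 0)
    (h : N.map (SpecialLinearGroup.map (ZMod.castHom (dvd_pow_self p hk) (ZMod p))) = ⊤) :
    N = ⊤ := by
  have hle : slCongKer n p k 1 (Nat.one_le_iff_ne_zero.2 hk) ≤ N :=
    slCongKer_le_of_layer h2 hk one_ne_zero _ fun Y hY ↦
      layer_one_of_surjective h2 (ZMod.castHom_surjective _) (by simp) h hY
  refine eq_top_iff.2 fun g _ ↦ ?_
  obtain ⟨y, hy, hyg⟩ : SpecialLinearGroup.map (ZMod.castHom (dvd_pow_self p hk) (ZMod p)) g ∈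
    N.map (SpecialLinearGroup.map (ZMod.castHom (dvd_pow_self p hk) (ZMod p))) :=
      h ▸ Subgroup.mem_top _
  have hgy : g * y⁻¹ ∈ N := hle <| (mem_slCongKer_iff _ _).2 <| by
    rw [pow_one]
    refine exists_coe_eq_one_add_smul (zmod_castHom_prime_eq_zero hk) ?_
    rw [map_mul, map_inv, mul_inv_eq_one, hyg]
  simpa using N.mul_mem hgy hy

lemma eq_top_of_not_subset_slCongKer_one_mul_center [Nontrivial (Fin n)] (h2 : (2 : ZMod p) ≠ 0)
    (h3 : (2 : ZMod p) ^ 2 ≠ 1) (hk : k ≠ 0)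
    (h : ¬ (N : Set (SpecialLinearGroup (Fin n) (ZMod (p ^ k)))) ⊆
      (slCongKer n p k 1 (Nat.one_le_iff_ne_zero.2 hk) : Set _) *
        (Subgroup.center (SpecialLinearGroup (Fin n) (ZMod (p ^ k))) : Set _)) :
    N = ⊤ := by
  have hsurj : Function.Surjective
      (SpecialLinearGroup.map (n := Fin n) (ZMod.castHom (dvd_pow_self p hk) (ZMod p))) :=
    SL_map_surjective (ZMod.castHom_surjective _)
  have : (N.map (SpecialLinearGroup.map (ZMod.castHom (dvd_pow_self p hk) (ZMod p)))).Normal :=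
    Subgroup.Normal.map inferInstance _ hsurj
  refine eq_top_of_map_eq_top h2 hk (SL_normal_eq_top h2 h3 _ fun hle ↦ h fun g hg ↦ ?_)
  obtain ⟨z, hz, hgz⟩ := exists_mul_center_of_map_le_center hk
    (hle (Subgroup.mem_map_of_mem _ hg))
  refine ⟨g * z⁻¹, (mem_slCongKer_iff _ _).2 ?_, z, hz, by simp⟩
  rw [pow_one]
  exact exists_coe_eq_one_add_smul (zmod_castHom_prime_eq_zero hk) hgz

lemma slCongKer_le_of_not_mem_succ [Nontrivial (Fin n)] (h2 : (2 : ZMod p) ≠ 0)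
    (hn : (n : ZMod p) ≠ 0) {i : ℕ} (hi : i ≠ 0) (hik : i + 1 ≤ k)
    {g : SpecialLinearGroup (Fin n) (ZMod (p ^ k))} (hgN : g ∈ N)
    (hg : g ∈ slCongKer n p k i (Nat.le_of_succ_le hik)) (hg' : g ∉ slCongKer n p k (i + 1) hik) :
    slCongKer n p k i (Nat.le_of_succ_le hik) ≤ N := by
  have hk : k ≠ 0 := by omega
  have hp0 : ZMod.castHom (dvd_pow_self p hk) (ZMod p) (p : ZMod (p ^ k)) = 0 := by simp
  obtain ⟨X, hX⟩ := (mem_slCongKer_iff _ g).1 hg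
  refine slCongKer_le_of_layer h2 hk hi _ fun Y hY ↦
    layer_of_nonscalar h2 (ZMod.castHom_surjective _) hp0 hi ⟨X, rfl, g, hgN, hX⟩
      (fun c hc ↦ hg' ((mem_slCongKer_iff _ g).2 ?_)) hY
  have htr := trace_map_eq_zero hp0 hi
    (zmod_castHom_eq_zero_of_pow_mul_eq_zero hk (show i < k by omega)) hX
  have hc0 : c = 0 := by
    rw [hc] at htr
    simpa [trace, hn] using htr
  rw [hc0, map_zero] at hc
  have hdvd : ∀ a b, ∃ z, X a b = (p : ZMod (p ^ k)) * z := fun a b ↦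
    zmod_castHom_prime_eq_zero hk _ (congrFun (congrFun hc a) b)
  choose Z hZ using hdvd
  refine ⟨Matrix.of Z, ?_⟩
  rw [hX, pow_succ, mul_smul]
  congr 2
  ext a b
  simp [hZ]

end PrimePower

end CongruenceSubgroups

/-- Proposition 3.10: for sufficiently large primes `p`, every
normal subgroup of `SL_n(ℤ/p^kℤ)` containing the center equals
`G_k^i · Z(G_k)` for some `0 ≤ i ≤ k`. -/
theorem normal_subgroups_SL_zmod_prime_pow (n : ℕ) (hn : 2 ≤ n) :
    ∃ p₀ : ℕ, p₀.Prime ∧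
      ∀ p : ℕ, p.Prime → p₀ ≤ p → ∀ k : ℕ, 1 ≤ k →
        ∀ N : Subgroup (Matrix.SpecialLinearGroup (Fin n) (ZMod (p ^ k))),
          N.Normal →
          Subgroup.center (Matrix.SpecialLinearGroup (Fin n) (ZMod (p ^ k))) ≤ N →
          ∃ (i : ℕ) (hi : i ≤ k),
            (N : Set (Matrix.SpecialLinearGroup (Fin n) (ZMod (p ^ k)))) =
              (↑(slCongKer n p k i hi) *
                ↑(Subgroup.center (Matrix.SpecialLinearGroup (Fin n) (ZMod (p ^ k)))) :
                Set (Matrix.SpecialLinearGroup (Fin n) (ZMod (p ^ k)))) := by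
  obtain ⟨p₀, hp₀n, hp₀⟩ := Nat.exists_infinite_primes (n + 4)
  refine ⟨p₀, hp₀, fun p hp hpp k hk N hN hZ ↦ ?_⟩
  have : Fact p.Prime := ⟨hp⟩
  have : Nontrivial (Fin n) := Fin.nontrivial_iff_two_le.2 hn
  have hcast (m : ℕ) (h0 : 0 < m) (hm : m < p) : (m : ZMod p) ≠ 0 := by
    rw [Ne, ZMod.natCast_eq_zero_iff]
    exact Nat.not_dvd_of_pos_of_lt h0 hm
  have h2 : (2 : ZMod p) ≠ 0 := by exact_mod_cast hcast 2 (by omega) (by omega)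
  have h3 : (2 : ZMod p) ^ 2 ≠ 1 := fun h ↦ by
    refine hcast 3 (by omega) (by omega) ?_
    push_cast
    linear_combination h
  have hn0 : (n : ZMod p) ≠ 0 := hcast n (by omega) (by omega)
  have hk0 : k ≠ 0 := by omega
  suffices H : ∃ (i : ℕ) (hi : i ≤ k), slCongKer n p k i hi ≤ N ∧
      (N : Set (Matrix.SpecialLinearGroup (Fin n) (ZMod (p ^ k)))) ⊆
        (slCongKer n p k i hi : Set _) *
          (Subgroup.center (Matrix.SpecialLinearGroup (Fin n) (ZMod (p ^ k))) : Set _) by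
    obtain ⟨i, hi, hle, hsub⟩ := H
    refine ⟨i, hi, hsub.antisymm ?_⟩
    rintro _ ⟨h, hh, z, hz, rfl⟩
    exact N.mul_mem (hle hh) (hZ hz)
  classical
  let P (i : ℕ) : Prop := ∃ hi : i ≤ k,
    (N : Set (Matrix.SpecialLinearGroup (Fin n) (ZMod (p ^ k)))) ⊆
      (slCongKer n p k i hi : Set _) *
        (Subgroup.center (Matrix.SpecialLinearGroup (Fin n) (ZMod (p ^ k))) : Set _)
  have hP0 : P 0 := ⟨k.zero_le, fun g _ ↦
    ⟨g, by rw [slCongKer_zero]; trivial, 1, one_mem _, mul_one g⟩⟩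
  obtain ⟨hi, hsub⟩ : P (Nat.findGreatest P k) := Nat.findGreatest_spec k.zero_le hP0
  have hmax (h : Nat.findGreatest P k + 1 ≤ k) : ¬ P (Nat.findGreatest P k + 1) :=
    Nat.findGreatest_is_greatest (Nat.lt_succ_self _) h
  generalize Nat.findGreatest P k = i at hi hsub hmax
  refine ⟨i, hi, ?_, hsub⟩
  rcases hi.eq_or_lt with rfl | hik
  · rw [slCongKer_self]
    exact bot_le
  have hnot := fun hs ↦ hmax hik ⟨hik, hs⟩
  rcases eq_or_ne i 0 with rfl | hi0
  · rw [eq_top_of_not_subset_slCongKer_one_mul_center h2 h3 hk0 hnot]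
    exact le_top
  · obtain ⟨g, hgN, hg⟩ := Set.not_subset.1 hnot
    obtain ⟨h, hh, z, hz, rfl⟩ := hsub hgN
    refine slCongKer_le_of_not_mem_succ h2 hn0 hi0 hik
      (by simpa using N.mul_mem hgN (N.inv_mem (hZ hz))) hh fun hh' ↦ hg ⟨h, hh', z, hz, rfl⟩
end

section
/- Let n ≥ 2, let N and m be positive integers with gcd(N, m) = 1, and let H = ker(SL_n(ℤ) → SL_n(ℤ/Nℤ)) be the principal congruence subgroup of level N. Then the reduction homomorphism SL_n(ℤ) → SL_n(ℤ/mℤ) maps H surjectively onto SL_n(ℤ/mℤ). (Proposition 3.11 instantiated at the simply-connected Chevalley group SL_n; the proof uses strong approximation.) -/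
/-- Entrywise reduction `SL_n(ℤ) → SL_n(ℤ/mℤ)`. -/
def slRedInt (n m : ℕ) :
    Matrix.SpecialLinearGroup (Fin n) ℤ →* Matrix.SpecialLinearGroup (Fin n) (ZMod m) :=
  Matrix.SpecialLinearGroup.map (Int.castRingHom (ZMod m))

theorem ZMod.exists_isUnit_add_mul {m : ℕ} [NeZero m] {a b : ZMod m} (h : IsCoprime a b) :
    ∃ t, IsUnit (a + t * b) := by
  obtain ⟨x, y, hxy⟩ := h
  set q := ∏ p ∈ m.primeFactors with ¬ p ∣ a.val, p with hq
  refine ⟨(q : ZMod m), ?_⟩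
  have hcast : a + q * b = ((a.val + q * b.val : ℕ) : ZMod m) := by simp
  rw [hcast, ZMod.isUnit_iff_coprime]
  refine Nat.Coprime.symm (Nat.coprime_of_dvd fun p hp hpm hpd ↦ ?_)
  have : Fact p.Prime := ⟨hp⟩
  have hmem : p ∈ m.primeFactors := Nat.mem_primeFactors.2 ⟨hp, hpm, NeZero.ne m⟩
  have hb : p ∣ a.val → p ∣ b.val → False := fun ha hb ↦ by
    have h1 := congrArg (ZMod.castHom hpm (ZMod p)) hxy
    rw [← ZMod.natCast_zmod_val a, ← ZMod.natCast_zmod_val b, map_add, map_mul, map_mul,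
      map_natCast, map_natCast, (ZMod.natCast_eq_zero_iff _ _).2 ha,
      (ZMod.natCast_eq_zero_iff _ _).2 hb, map_one] at h1
    simp at h1
  by_cases ha : p ∣ a.val
  · rcases hp.dvd_mul.1 ((Nat.dvd_add_right ha).1 hpd) with hd | hd
    · obtain ⟨l, hl, hpl⟩ := (hp.prime.dvd_finsetProd_iff _).1 hd
      rw [Finset.mem_filter] at hl
      rw [(Nat.prime_dvd_prime_iff_eq hp (Nat.prime_of_mem_primeFactors hl.1)).1 hpl] at ha
      exact hl.2 ha
    · exact hb ha hd
  · have hpq : p ∣ q := Finset.dvd_prod_of_mem (fun i ↦ i) (Finset.mem_filter.2 ⟨hmem, ha⟩)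
    exact ha ((Nat.dvd_add_left (hpq.mul_right _)).1 hpd)

namespace Matrix.SpecialLinearGroup

variable {ι R : Type*} [Fintype ι] [DecidableEq ι] [CommRing R]

theorem transvection_smul {i j : ι} (hij : i ≠ j) (c : R) (v : ι → R) :
    transvection hij c • v = v + Pi.single i (c * v j) := by
  simp [SpecialLinearGroup.smul_def, transvection_coe, add_mulVec, Matrix.single_mulVec_eq,
    ← Pi.single_smul]

variable {G : Subgroup (SpecialLinearGroup ι R)}

theorem exists_mem_smul_eq_add_single_sum {k : ι} {s : Finset ι} (hk : k ∉ s)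
    (hG : ∀ i (hi : k ≠ i) (c : R), i ∈ s → transvection hi c ∈ G) (d v : ι → R) :
    ∃ g ∈ G, g • v = v + Pi.single k (∑ i ∈ s, d i * v i) := by
  induction s using Finset.induction_on with
  | empty => exact ⟨1, one_mem _, by simp⟩
  | insert r s hr ih =>
    rw [Finset.mem_insert, not_or] at hk
    obtain ⟨g, hg, hgv⟩ := ih hk.2 fun i hi c his ↦ hG i hi c (Finset.mem_insert_of_mem his)
    refine ⟨transvection hk.1 (d r) * g, mul_mem (hG r hk.1 _ (Finset.mem_insert_self _ _)) hg, ?_⟩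
    rw [mul_smul, hgv, transvection_smul, Finset.sum_insert hr, Pi.add_apply,
      Pi.single_eq_of_ne (Ne.symm hk.1), add_zero, add_assoc, ← Pi.single_add, add_comm (d r * _)]

theorem exists_mem_smul_eq_add_sum_single {k : ι}
    (hG : ∀ i (hi : i ≠ k) (c : R), transvection hi c ∈ G) (d v : ι → R) {s : Finset ι}
    (hk : k ∉ s) : ∃ g ∈ G, g • v = v + ∑ i ∈ s, Pi.single i (d i * v k) := by
  induction s using Finset.induction_on with
  | empty => exact ⟨1, one_mem _, by simp⟩
  | insert r s hr ih =>
    rw [Finset.mem_insert, not_or] at hk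
    obtain ⟨g, hg, hgv⟩ := ih hk.2
    refine ⟨transvection (Ne.symm hk.1) (d r) * g, mul_mem (hG r _ _) hg, ?_⟩
    have h0 : (∑ i ∈ s, Pi.single i (d i * v k) : ι → R) k = 0 := by
      rw [Finset.sum_apply]
      exact Finset.sum_eq_zero fun i hi ↦ Pi.single_eq_of_ne (by rintro rfl; exact hk.2 hi) _
    rw [mul_smul, hgv, transvection_smul, Finset.sum_insert hr, Pi.add_apply, h0, add_zero,
      add_assoc, add_comm (Pi.single r _)]

theorem exists_mem_smul_eq_single {k : ι}
    (hG : ∀ i (hi : i ≠ k) (c : R), transvection hi c ∈ G) {v : ι → R} (hv : v k = 1) :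
    ∃ g ∈ G, g • v = Pi.single k 1 := by
  obtain ⟨g, hg, hgv⟩ := exists_mem_smul_eq_add_sum_single hG (-v) v (Finset.notMem_erase k .univ)
  refine ⟨g, hg, ?_⟩
  rw [hgv, Finset.sum_erase_eq_sub (Finset.mem_univ k)]
  ext i
  by_cases hi : i = k <;> simp [hi, hv, Finset.sum_apply, Pi.single_apply]

theorem exists_mem_smul_eq_single_of_sum_eq_one
    (hR : ∀ a b : R, IsCoprime a b → ∃ t, IsUnit (a + t * b)) {T : Finset ι} {k r : ι}
    (hk : k ∈ T) (hr : r ∈ T) (hrk : r ≠ k)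
    (hG : ∀ i j (hij : i ≠ j) (c : R), j ∈ T → transvection hij c ∈ G) {c v : ι → R}
    (hv : ∑ i ∈ T, c i * v i = 1) : ∃ g ∈ G, g • v = Pi.single k 1 := by
  rw [← Finset.add_sum_erase _ _ hk] at hv
  obtain ⟨t, ht⟩ := hR (v k) (∑ i ∈ T.erase k, c i * v i) ⟨c k, 1, by rw [one_mul, hv]⟩
  obtain ⟨g, hg, hgv⟩ := exists_mem_smul_eq_add_single_sum (G := G) (Finset.notMem_erase k T)
    (fun i hi c his ↦ hG k i hi c (Finset.mem_of_mem_erase his)) (fun i ↦ t * c i) v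
  have hgk : (g • v) k = v k + t * ∑ i ∈ T.erase k, c i * v i := by
    simp [hgv, Finset.mul_sum, mul_assoc]
  rw [← hgk] at ht
  obtain ⟨u, hu⟩ := ht
  set w := g • v
  obtain ⟨g', hg', hgv'⟩ := exists_mem_smul_eq_single (G := G) (k := k)
    (fun i hi c ↦ hG i k hi c hk)
    (v := transvection hrk.symm (1 - w k) • transvection hrk (↑u⁻¹ * (1 - w r)) • w) (by
      simp only [transvection_smul, Pi.add_apply, Pi.single_eq_same, Pi.single_eq_of_ne hrk.symm,
        add_zero, ← hu]
      linear_combination ((1 - (u : R)) * (1 - w r)) * u.inv_mul)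
  exact ⟨g' * (transvection hrk.symm (1 - w k) * (transvection hrk (↑u⁻¹ * (1 - w r)) * g)),
    mul_mem hg' (mul_mem (hG _ _ _ _ hr) (mul_mem (hG _ _ _ _ hk) hg)),
    by simpa only [mul_smul] using hgv'⟩

theorem exists_mem_forall_smul_single
    (hR : ∀ a b : R, IsCoprime a b → ∃ t, IsUnit (a + t * b))
    (hG : ∀ (i j : ι) (hij : i ≠ j) (c : R), transvection hij c ∈ G)
    (A : SpecialLinearGroup ι R) (S : Finset ι) :
    ∃ g ∈ G, ∀ j ∈ S, (g * A) • (Pi.single j 1 : ι → R) = Pi.single j 1 := by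
  induction S using Finset.induction_on with
  | empty => exact ⟨1, one_mem _, by simp⟩
  | insert k S hkS ih =>
    obtain ⟨g, hg, hgS⟩ := ih
    set B := g * A
    let H := G ⊓ fixingSubgroup (SpecialLinearGroup ι R)
      ((fun j ↦ (Pi.single j 1 : ι → R)) '' (S : Set ι))
    have hH (i j : ι) (hij : i ≠ j) (c : R) (hj : j ∈ Sᶜ) : transvection hij c ∈ H := by
      refine ⟨hG i j hij c, (mem_fixingSubgroup_iff _).2 ?_⟩
      rintro _ ⟨l, hl, rfl⟩
      have hjl : j ≠ l := fun h ↦ Finset.mem_compl.1 hj (h ▸ hl)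
      simp [transvection_smul, hjl]
    suffices h : ∃ h ∈ H, h • B • (Pi.single k 1 : ι → R) = Pi.single k 1 by
      obtain ⟨h, hh, hhk⟩ := h
      refine ⟨h * g, mul_mem hh.1 hg, fun j hj ↦ ?_⟩
      rw [mul_assoc, mul_smul]
      obtain rfl | hj := Finset.mem_insert.1 hj
      · exact hhk
      · rw [hgS j hj]
        exact (mem_fixingSubgroup_iff _).1 hh.2 _ ⟨j, hj, rfl⟩
    have hcol (C : SpecialLinearGroup ι R) (i j : ι) :
        (C • (Pi.single j 1 : ι → R)) i = C i j := by
      simp [SpecialLinearGroup.smul_def]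
    have hkT : k ∈ Sᶜ := Finset.mem_compl.2 hkS
    by_cases hex : ∃ r ∈ Sᶜ, r ≠ k
    · obtain ⟨r, hr, hrk⟩ := hex
      refine exists_mem_smul_eq_single_of_sum_eq_one (c := fun i ↦ B⁻¹ k i) hR hkT hr hrk hH ?_
      have hinv : ∑ i, B⁻¹ k i * B i k = 1 := by
        rw [← Matrix.mul_apply, ← coe_mul, inv_mul_cancel, coe_one, one_apply_eq]
      rw [← Finset.sum_compl_add_sum S, Finset.sum_eq_zero (s := S), add_zero] at hinv
      · simpa only [hcol] using hinv
      intro i hi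
      have hfix := inv_smul_eq_iff.2 (hgS i hi).symm
      rw [← hcol, hfix, Pi.single_eq_of_ne (by rintro rfl; exact hkS hi), zero_mul]
    · push Not at hex
      refine exists_mem_smul_eq_single (fun i hi c ↦ hH i k hi c hkT) ?_
      have hB : (B : Matrix ι ι R) = (1 : Matrix ι ι R).updateCol k (fun i ↦ B i k) := by
        ext i j
        by_cases hj : j = k
        · simp [hj]
        · have hjS : j ∈ S := by
            by_contra h
            exact hj (hex j (Finset.mem_compl.2 h))
          rw [updateCol_ne hj, ← hcol, hgS j hjS, Pi.single_apply, one_apply]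
      have hdet := B.det_coe
      rw [hB, ← cramer_apply, cramer_one] at hdet
      rw [hcol]
      exact hdet

/-- Over a ring of stable rank one, a subgroup of the special linear group which contains all
elementary transvections is everything. -/
theorem eq_top_of_transvection_mem
    (hR : ∀ a b : R, IsCoprime a b → ∃ t, IsUnit (a + t * b))
    (hG : ∀ (i j : ι) (hij : i ≠ j) (c : R), transvection hij c ∈ G) : G = ⊤ := by
  refine (Subgroup.eq_top_iff' G).2 fun A ↦ ?_
  obtain ⟨g, hg, hgA⟩ := exists_mem_forall_smul_single hR hG A Finset.univ
  have h1 : g * A = 1 := by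
    ext i j
    simpa [SpecialLinearGroup.smul_def, one_apply, Pi.single_apply] using
      congrFun (hgA j (Finset.mem_univ j)) i
  rw [eq_inv_of_mul_eq_one_right h1]
  exact inv_mem hg

theorem map_transvection {S : Type*} [CommRing S] (f : R →+* S) {i j : ι} (hij : i ≠ j) (c : R) :
    map f (transvection hij c) = transvection hij (f c) := by
  ext a b
  simp [transvection_coe, Matrix.single_apply, Matrix.one_apply, apply_ite f]

end Matrix.SpecialLinearGroup

/-- Proposition 3.11: for coprime `N, m`, the principal
congruence subgroup of level `N` in `SL_n(ℤ)` surjects onto `SL_n(ℤ/mℤ)`. -/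
theorem principal_congruence_subgroup_surjects (n : ℕ) (hn : 2 ≤ n)
    (N m : ℕ) (hN : 0 < N) (hm : 0 < m) (hcop : Nat.Coprime N m) :
    Subgroup.map (slRedInt n m) (slRedInt n N).ker = ⊤ := by
  have : NeZero m := ⟨hm.ne'⟩
  refine Matrix.SpecialLinearGroup.eq_top_of_transvection_mem
    (fun a b ↦ ZMod.exists_isUnit_add_mul) fun i j hij c ↦ ?_
  refine ⟨.transvection hij (N * ((N : ZMod m)⁻¹ * c).val : ℤ), ?_, ?_⟩
  · rw [SetLike.mem_coe, MonoidHom.mem_ker, slRedInt, Matrix.SpecialLinearGroup.map_transvection]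
    simp
  · rw [slRedInt, Matrix.SpecialLinearGroup.map_transvection]
    simp [← mul_assoc, ZMod.coe_mul_inv_eq_one N hcop]
end

section
/- Let n ≥ 3 and let X be a finite generating set of SL_n(ℤ). For integers i ≠ j in {1,…,n} and z ∈ ℤ, let E_{ij}(z) = I + z·e_{ij} ∈ SL_n(ℤ) denote the elementary matrix, where e_{ij} is the matrix unit. Then there exists a positive constant M such that for all integers z ≥ 2 and all i ≠ j, the word length satisfies ‖E_{ij}(z)‖_X ≤ M·log(z). (Proposition 3.13 instantiated at G = SL_n of rank n−1 ≥ 2, a root subgroup being t ↦ E_{ij}(t); the proof uses Lubotzky–Mozes–Raghunathan.) -/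
open scoped Pointwise

section FarbDefs

variable {G : Type*} [Group G]

/-- Word length of `g` with respect to a generating set `X` (symmetrized). -/
noncomputable def wordLength (X : Set G) (g : G) : ℕ :=
  sInf {n | ∃ l : List G, l.length = n ∧ (∀ x ∈ l, x ∈ X ∨ x⁻¹ ∈ X) ∧ l.prod = g}

/-- `farbD g` is the minimal cardinality of a finite quotient of `G` detecting `g`. -/
noncomputable def farbD (g : G) : ℕ :=
  sInf {k | ∃ N : Subgroup G, N.Normal ∧ N.FiniteIndex ∧ g ∉ N ∧ N.index = k}

/-- The normal Farb growth function of `G` with respect to `X`. -/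
noncomputable def farbF (X : Set G) (n : ℕ) : ℕ :=
  sSup {d | ∃ g : G, g ≠ 1 ∧ wordLength X g ≤ n ∧ farbD g = d}

/-- The auxiliary function `F^k`. -/
noncomputable def farbFk (k : ℕ) (X : Set G) (n : ℕ) : ℕ :=
  sSup {d | ∃ g : G, g ^ k ≠ 1 ∧ wordLength X g ≤ n ∧ farbD (g ^ k) = d}

/-- `f ≼ g` : there is `M` with `f n ≤ M * g (M * n)` for all `n`. -/
def FarbPreceq (f g : ℕ → ℕ) : Prop := ∃ M : ℕ, 0 < M ∧ ∀ n, f n ≤ M * g (M * n)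

/-- `f ≈ g`. -/
def FarbEquiv (f g : ℕ → ℕ) : Prop := FarbPreceq f g ∧ FarbPreceq g f

/-- A group is residually finite if every nontrivial element is detected by a
finite quotient. -/
def ResiduallyFinite (G : Type*) [Group G] : Prop :=
  ∀ g : G, g ≠ 1 → ∃ N : Subgroup G, N.Normal ∧ N.FiniteIndex ∧ g ∉ N

end FarbDefs


/-- The elementary matrix `E_{ij}(z) = I + z·e_{ij}` as an element of `SL_n(ℤ)`. -/
def elemMatrix (n : ℕ) (i j : Fin n) (hij : i ≠ j) (z : ℤ) :
    Matrix.SpecialLinearGroup (Fin n) ℤ :=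
  ⟨Matrix.transvection i j z, Matrix.det_transvection_of_ne i j hij z⟩

section WordLength

variable {G : Type*} [Group G] {X : Set G}

theorem wordLength_prod_le {l : List G} (hl : ∀ x ∈ l, x ∈ X ∨ x⁻¹ ∈ X) :
    wordLength X l.prod ≤ l.length :=
  Nat.sInf_le ⟨l, rfl, hl, rfl⟩

theorem exists_list_length_eq_wordLength (hX : Subgroup.closure X = ⊤) (g : G) :
    ∃ l : List G, l.length = wordLength X g ∧ (∀ x ∈ l, x ∈ X ∨ x⁻¹ ∈ X) ∧ l.prod = g := by
  have hmem : g ∈ (Subgroup.closure X).toSubmonoid := hX ▸ Subgroup.mem_top g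
  rw [Subgroup.closure_toSubmonoid] at hmem
  obtain ⟨l, hl, hg⟩ := Submonoid.exists_list_of_mem_closure hmem
  exact Nat.sInf_mem (s := {n | ∃ l : List G, l.length = n ∧ (∀ x ∈ l, x ∈ X ∨ x⁻¹ ∈ X) ∧
    l.prod = g}) ⟨l.length, l, rfl, hl, hg⟩

theorem wordLength_one : wordLength X (1 : G) = 0 :=
  Nat.le_zero.mp (wordLength_prod_le (l := []) (by simp))

theorem wordLength_mul_le (hX : Subgroup.closure X = ⊤) (g h : G) :
    wordLength X (g * h) ≤ wordLength X g + wordLength X h := by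
  obtain ⟨l, hl, hlX, rfl⟩ := exists_list_length_eq_wordLength hX g
  obtain ⟨r, hr, hrX, rfl⟩ := exists_list_length_eq_wordLength hX h
  rw [← hl, ← hr, ← List.length_append, ← List.prod_append]
  exact wordLength_prod_le fun x hx => (List.mem_append.mp hx).elim (hlX x) (hrX x)

theorem wordLength_inv_le (hX : Subgroup.closure X = ⊤) (g : G) :
    wordLength X g⁻¹ ≤ wordLength X g := by
  obtain ⟨l, hl, hlX, rfl⟩ := exists_list_length_eq_wordLength hX g
  rw [← hl, List.prod_inv_reverse]
  refine (wordLength_prod_le fun x hx => ?_).trans (by simp)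
  simp only [List.mem_reverse, List.mem_map] at hx
  obtain ⟨y, hy, rfl⟩ := hx
  simpa [or_comm] using hlX y hy

theorem wordLength_pow_le (hX : Subgroup.closure X = ⊤) (g : G) (m : ℕ) :
    wordLength X (g ^ m) ≤ m * wordLength X g := by
  induction m with
  | zero => simp [wordLength_one]
  | succ m ih =>
    rw [pow_succ, add_mul, one_mul]
    exact (wordLength_mul_le hX _ _).trans (Nat.add_le_add_right ih _)

end WordLength

section CatMap

/-- The orbit of `(1, 0)` under `(a, b) ↦ (2 * a + b, a + b)`. -/
def catOrbit : ℕ → ℕ × ℕ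
  | 0 => (1, 0)
  | m + 1 => (2 * (catOrbit m).1 + (catOrbit m).2, (catOrbit m).1 + (catOrbit m).2)

theorem catOrbit_snd_le_fst (m : ℕ) : (catOrbit m).2 ≤ (catOrbit m).1 := by
  cases m <;> simp only [catOrbit] <;> omega

theorem two_pow_le_catOrbit_fst (m : ℕ) : 2 ^ m ≤ (catOrbit m).1 := by
  induction m with
  | zero => simp [catOrbit]
  | succ m ih => rw [pow_succ]; simp only [catOrbit]; omega

variable {G : Type*} [Group G] {A : G} {U : ℤ → ℤ → G}

theorem pow_mul_catOrbit (hA : ∀ a b, U a b * A = A * U (2 * a + b) (a + b)) (d : ℤ) (m : ℕ) :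
    A ^ m * U (d * (catOrbit m).1) (d * (catOrbit m).2) = U d 0 * A ^ m := by
  induction m with
  | zero => simp [catOrbit]
  | succ m ih =>
    have h := hA (d * (catOrbit m).1) (d * (catOrbit m).2)
    have e₁ : d * ((catOrbit (m + 1)).1 : ℤ) =
        2 * (d * (catOrbit m).1) + d * (catOrbit m).2 := by
      simp only [catOrbit]; push_cast; ring
    have e₂ : d * ((catOrbit (m + 1)).2 : ℤ) = d * (catOrbit m).1 + d * (catOrbit m).2 := by
      simp only [catOrbit]; push_cast; ring
    rw [e₁, e₂, pow_succ, mul_assoc, ← h, ← mul_assoc, ih, mul_assoc]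

/-- Expanding an integer greedily along the orbit of the cat map `A` writes it, up to an
uncontrolled second coordinate, as a Horner-type word of length linear in the number of digits. -/
theorem exists_wordLength_pow_mul_le {X : Set G} (hX : Subgroup.closure X = ⊤)
    (hU : ∀ a b c d, U (a + c) (b + d) = U a b * U c d)
    (hA : ∀ a b, U a b * A = A * U (2 * a + b) (a + b)) {L : ℕ}
    (hL : wordLength X A + 2 * wordLength X (U 1 0) ≤ L) (m z : ℕ) (hz : z < (catOrbit m).1) :
    ∃ w : ℤ, wordLength X (A ^ m * U z w) ≤ m * L := by
  have hU0 : U 0 0 = 1 := by simpa using hU 0 0 0 0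
  induction m generalizing z with
  | zero =>
    obtain rfl : z = 0 := by simpa [catOrbit] using hz
    exact ⟨0, by simp [hU0, wordLength_one]⟩
  | succ m ih =>
    set f := (catOrbit m).1 with hf
    have hfpos : 0 < f := (Nat.two_pow_pos m).trans_le (two_pow_le_catOrbit_fst m)
    obtain ⟨w, hw⟩ := ih (z % f) (Nat.mod_lt z hfpos)
    have hd : z / f < 3 := by
      rw [Nat.div_lt_iff_lt_mul hfpos]
      have := catOrbit_snd_le_fst m
      simp only [catOrbit] at hz
      omega
    have hdigit : wordLength X (U ((z / f : ℕ) : ℤ) 0) ≤ 2 * wordLength X (U 1 0) := by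
      generalize z / f = d at hd
      interval_cases d
      · simp [hU0, wordLength_one]
      · simp only [Nat.cast_one]; omega
      · have h2 : U ((2 : ℕ) : ℤ) 0 = U 1 0 * U 1 0 := by rw [← hU]; norm_num
        rw [h2]
        have := wordLength_mul_le hX (U 1 0) (U 1 0)
        omega
    refine ⟨((z / f : ℕ) : ℤ) * (catOrbit m).2 + w, ?_⟩
    have hsplit : (z : ℤ) = ((z / f : ℕ) : ℤ) * f + ((z % f : ℕ) : ℤ) := by
      exact_mod_cast (Nat.div_add_mod' z f).symm
    have heq : A ^ (m + 1) * U z (((z / f : ℕ) : ℤ) * (catOrbit m).2 + w) =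
        A * (U ((z / f : ℕ) : ℤ) 0 * (A ^ m * U ((z % f : ℕ) : ℤ) w)) := by
      conv_lhs => rw [hsplit]
      rw [hU, pow_succ', mul_assoc, ← mul_assoc (A ^ m), hf, pow_mul_catOrbit hA, mul_assoc]
    rw [heq, add_mul, one_mul]
    have h₁ := wordLength_mul_le hX A (U ((z / f : ℕ) : ℤ) 0 * (A ^ m * U ((z % f : ℕ) : ℤ) w))
    have h₂ := wordLength_mul_le hX (U ((z / f : ℕ) : ℤ) 0) (A ^ m * U ((z % f : ℕ) : ℤ) w)
    omega

end CatMap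

section Elementary

variable {n : ℕ} {i j k : Fin n}

theorem elemMatrix_add (hij : i ≠ j) (a b : ℤ) :
    elemMatrix n i j hij (a + b) = elemMatrix n i j hij a * elemMatrix n i j hij b :=
  Subtype.ext (Matrix.transvection_mul_transvection_same i j hij a b).symm

theorem elemMatrix_commute (hij : i ≠ j) (hik : i ≠ k) (a b : ℤ) :
    Commute (elemMatrix n i j hij a) (elemMatrix n i k hik b) := by
  apply Subtype.ext
  change Matrix.transvection i j a * Matrix.transvection i k b =
    Matrix.transvection i k b * Matrix.transvection i j a
  simp [Matrix.transvection, add_mul, mul_add, Matrix.single_mul_single_of_ne,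
    hij.symm, hik.symm]
  abel

theorem elemMatrix_mul_elemMatrix (hij : i ≠ j) (hjk : j ≠ k) (hik : i ≠ k) (a b : ℤ) :
    elemMatrix n i j hij a * elemMatrix n j k hjk b =
      elemMatrix n j k hjk b * (elemMatrix n i j hij a * elemMatrix n i k hik (a * b)) := by
  apply Subtype.ext
  change Matrix.transvection i j a * Matrix.transvection j k b =
    Matrix.transvection j k b * (Matrix.transvection i j a * Matrix.transvection i k (a * b))
  simp [Matrix.transvection, add_mul, mul_add, Matrix.single_mul_single_of_ne,
    hij.symm, hik.symm]
  abel

theorem elemMatrix_commute_of_col_eq (hik : i ≠ k) (hjk : j ≠ k) (a b : ℤ) :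
    Commute (elemMatrix n i k hik a) (elemMatrix n j k hjk b) := by
  apply Subtype.ext
  change Matrix.transvection i k a * Matrix.transvection j k b =
    Matrix.transvection j k b * Matrix.transvection i k a
  simp [Matrix.transvection, add_mul, mul_add, Matrix.single_mul_single_of_ne,
    hik.symm, hjk.symm]
  abel

theorem elemMatrix_mul_elemMatrix_shear (hij : i ≠ j) (hik : i ≠ k) (hjk : j ≠ k) (a b : ℤ) :
    elemMatrix n i j hij a * elemMatrix n i k hik b * elemMatrix n j k hjk 1 =
      elemMatrix n j k hjk 1 * (elemMatrix n i j hij a * elemMatrix n i k hik (a + b)) := by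
  rw [mul_assoc, (elemMatrix_commute_of_col_eq hik hjk b 1).eq, ← mul_assoc,
    elemMatrix_mul_elemMatrix hij hjk hik, mul_one, elemMatrix_add hik a b]
  simp only [mul_assoc]

theorem wordLength_elemMatrix_le_log {X : Set (Matrix.SpecialLinearGroup (Fin n) ℤ)}
    (hX : Subgroup.closure X = ⊤) {K : ℕ}
    (hK : ∀ (i j : Fin n) (hij : i ≠ j), wordLength X (elemMatrix n i j hij 1) ≤ K)
    (hij : i ≠ j) (hik : i ≠ k) (hjk : j ≠ k) (z : ℕ) :
    wordLength X (elemMatrix n i k hik z) ≤ 12 * K * (Nat.log 2 z + 1) + 2 * K := by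
  set m := Nat.log 2 z + 1
  set S := elemMatrix n j k hjk 1 with hS
  set T := elemMatrix n k j hjk.symm 1 with hT
  set U : ℤ → ℤ → Matrix.SpecialLinearGroup (Fin n) ℤ :=
    fun a b => elemMatrix n i j hij a * elemMatrix n i k hik b with hUdef
  have hU : ∀ a b c d, U (a + c) (b + d) = U a b * U c d := fun a b c d => by
    simp only [hUdef, elemMatrix_add]
    rw [mul_assoc, mul_assoc, ← mul_assoc (elemMatrix n i j hij c),
      (elemMatrix_commute hij hik c b).eq]
    simp only [mul_assoc]
  have hUS : ∀ a b, U a b * S = S * U a (a + b) := elemMatrix_mul_elemMatrix_shear hij hik hjk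
  have hUT : ∀ a b, U a b * T = T * U (a + b) b := fun a b => by
    simp only [hUdef]
    rw [(elemMatrix_commute hij hik a b).eq, hT, elemMatrix_mul_elemMatrix_shear,
      (elemMatrix_commute hij hik (a + b) b).eq, add_comm a b]
  have hA : ∀ a b, U a b * (S * T) = S * T * U (2 * a + b) (a + b) := fun a b => by
    rw [← mul_assoc, hUS, mul_assoc, hUT, mul_assoc]
    ring_nf
  have hE0 : elemMatrix n i k hik 0 = 1 := by simpa using elemMatrix_add hik 0 0
  have hST : wordLength X (S * T) ≤ 2 * K := by
    have := wordLength_mul_le hX S T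
    have : wordLength X S ≤ K := hK j k hjk
    have : wordLength X T ≤ K := hK k j hjk.symm
    omega
  have hL : wordLength X (S * T) + 2 * wordLength X (U 1 0) ≤ 4 * K := by
    have : wordLength X (U 1 0) ≤ K := by
      simp only [hUdef, hE0, mul_one]
      exact hK i j hij
    omega
  have hzm : z < (catOrbit m).1 :=
    (Nat.lt_pow_succ_log_self one_lt_two z).trans_le (two_pow_le_catOrbit_fst m)
  obtain ⟨w, hw⟩ := exists_wordLength_pow_mul_le hX hU hA hL m z hzm
  have hUzw : wordLength X (U z w) ≤ m * (6 * K) := by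
    have h₁ := wordLength_mul_le hX ((S * T) ^ m)⁻¹ ((S * T) ^ m * U z w)
    rw [inv_mul_cancel_left] at h₁
    have h₂ := wordLength_inv_le hX ((S * T) ^ m)
    have h₃ := wordLength_pow_le hX (S * T) m
    nlinarith [Nat.mul_le_mul_left m hST]
  have hcomm : elemMatrix n i k hik z = (S * U z w)⁻¹ * (U z w * S) := by
    rw [hUS, eq_inv_mul_iff_mul_eq, mul_assoc]
    simp only [hUdef]
    rw [mul_assoc, ← elemMatrix_add, add_comm w]
  rw [hcomm]
  have h₁ := wordLength_mul_le hX (S * U z w)⁻¹ (U z w * S)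
  have h₂ := wordLength_inv_le hX (S * U z w)
  have h₃ := wordLength_mul_le hX S (U z w)
  have h₄ := wordLength_mul_le hX (U z w) S
  have h₅ : wordLength X S ≤ K := hK j k hjk
  nlinarith

end Elementary

/-- Proposition 3.13, via Lubotzky–Mozes–Raghunathan: for
`n ≥ 3` and any finite generating set `X` of `SL_n(ℤ)`, the word length of the
elementary matrices satisfies `‖E_{ij}(z)‖_X ≤ M·log z`. -/
theorem wordLength_elementary_log (n : ℕ) (hn : 3 ≤ n)
    (X : Finset (Matrix.SpecialLinearGroup (Fin n) ℤ))
    (hX : Subgroup.closure (X : Set (Matrix.SpecialLinearGroup (Fin n) ℤ)) = ⊤) :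
    ∃ M : ℝ, 0 < M ∧
      ∀ z : ℤ, 2 ≤ z → ∀ (i j : Fin n) (hij : i ≠ j),
        (wordLength (X : Set (Matrix.SpecialLinearGroup (Fin n) ℤ))
            (elemMatrix n i j hij z) : ℝ) ≤ M * Real.log z := by
  obtain ⟨K, hK⟩ := Finite.exists_le
    (fun p : {p : Fin n × Fin n // p.1 ≠ p.2} =>
      wordLength (X : Set (Matrix.SpecialLinearGroup (Fin n) ℤ))
        (elemMatrix n p.1.1 p.1.2 p.2 1))
  have hlog2 : 0 < Real.log 2 := Real.log_pos one_lt_two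
  refine ⟨28 * K / Real.log 2 + 1, by positivity, fun z hz i j hij => ?_⟩
  lift z to ℕ using by omega
  have hz2 : 2 ≤ z := by exact_mod_cast hz
  obtain ⟨k, hk⟩ : ∃ k : Fin n, k ∉ ({i, j} : Finset (Fin n)) := by
    refine Finset.exists_mem_notMem_of_card_lt_card (s := {i, j}) (t := Finset.univ) ?_ |>.imp
      fun _ h => h.2
    have := Finset.card_le_two (a := i) (b := j)
    simp only [Finset.card_univ, Fintype.card_fin]
    omega
  simp only [Finset.mem_insert, Finset.mem_singleton, not_or] at hk
  have hlen := wordLength_elemMatrix_le_log hX (fun i j h => hK ⟨(i, j), h⟩)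
    (Ne.symm hk.1) hij hk.2 z
  have hone : 1 ≤ Nat.log 2 z := Nat.log_pos one_lt_two hz2
  have hreal : (Nat.log 2 z : ℝ) ≤ Real.log z / Real.log 2 := by
    simpa [Real.logb] using Real.natLog_le_logb z 2
  have hlogz : 0 ≤ Real.log z := Real.log_natCast_nonneg z
  have hbound : wordLength (X : Set (Matrix.SpecialLinearGroup (Fin n) ℤ))
      (elemMatrix n i j hij z) ≤ 28 * K * Nat.log 2 z := by
    nlinarith [Nat.mul_le_mul_left K hone]
  calc (wordLength (X : Set (Matrix.SpecialLinearGroup (Fin n) ℤ))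
        (elemMatrix n i j hij z) : ℝ) ≤ 28 * K * Nat.log 2 z := by exact_mod_cast hbound
    _ ≤ 28 * K * (Real.log z / Real.log 2) := by gcongr
    _ ≤ (28 * K / Real.log 2 + 1) * Real.log z := by
        rw [add_mul, one_mul]
        have : 28 * (K : ℝ) * (Real.log z / Real.log 2) = 28 * K / Real.log 2 * Real.log z := by
          ring
        linarith
    _ = (28 * K / Real.log 2 + 1) * Real.log ((z : ℤ) : ℝ) := by simp
end

section
/- Let m ≥ 2, let K ⊆ ℂ be a number field (a subfield of ℂ finite-dimensional over ℚ) with ring of integers 𝓞_K, let b ∈ 𝓞_K be nonzero, and let 𝓞_{K,b} = 𝓞_K[1/b] ⊆ ℂ. Let Γ be a finitely generated subgroup of SL_m(ℂ) such that SL_m(𝓞_{K,b}) ∩ Γ has finite index in Γ. Then there exist a number field L ⊆ ℂ containing K, a nonzero integer f, and a group homomorphism φ : Γ → SL_m(𝓞_{L,f}) with finite kernel, where 𝓞_{L,f} = 𝓞_L[1/f]. (Proposition 4.3 instantiated at G = SL_m.) -/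
/-- The ring of integers of a subfield `K` of `ℂ`, as a subring of `ℂ`. -/
def ringOfIntegersIn (K : Subfield ℂ) : Subring ℂ :=
  (integralClosure ℤ ℂ).toSubring ⊓ K.toSubring

/-- The subring `O[1/b]` of `ℂ` generated by a subring `O` and `1/b`. -/
def awayIn (O : Subring ℂ) (b : ℂ) : Subring ℂ :=
  Subring.closure ((O : Set ℂ) ∪ {b⁻¹})

/-- `SL_m(R)` for a subring `R ⊆ ℂ`, as a subgroup of `SL_m(ℂ)`. -/
def slOver (m : ℕ) (R : Subring ℂ) : Subgroup (Matrix.SpecialLinearGroup (Fin m) ℂ) :=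
  (Matrix.SpecialLinearGroup.map R.subtype).range

theorem mem_slOver_iff {m : ℕ} {R : Subring ℂ} {g : Matrix.SpecialLinearGroup (Fin m) ℂ} :
    g ∈ slOver m R ↔ ∀ i j, g i j ∈ R := by
  constructor
  · rintro ⟨h, rfl⟩ i j
    exact (h i j).2
  · intro h
    refine ⟨⟨Matrix.of fun i j => ⟨g i j, h i j⟩, ?_⟩, ?_⟩
    · apply R.subtype_injective
      rw [RingHom.map_det, map_one]
      exact g.2
    · ext i j
      rfl

theorem awayIn_ringOfIntegersIn_le {K : Subfield ℂ} {b : ℂ} (hb : b ∈ ringOfIntegersIn K) :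
    awayIn (ringOfIntegersIn K) b ≤ K.toSubring := by
  refine Subring.closure_le.2 (Set.union_subset (fun x hx => hx.2) ?_)
  rintro _ rfl
  exact K.inv_mem hb.2

theorem mem_awayIn_of_isIntegral_mul {L : Subfield ℂ} {f : ℤ} (hf : f ≠ 0) {x : ℂ} (hx : x ∈ L)
    (hfx : IsIntegral ℤ ((f : ℂ) * x)) : x ∈ awayIn (ringOfIntegersIn L) (f : ℂ) := by
  have hf' : (f : ℂ) ≠ 0 := Int.cast_ne_zero.2 hf
  have hmul : (f : ℂ) * x ∈ awayIn (ringOfIntegersIn L) (f : ℂ) :=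
    Subring.subset_closure (Or.inl ⟨hfx, L.mul_mem (intCast_mem L f) hx⟩)
  have hinv : (f : ℂ)⁻¹ ∈ awayIn (ringOfIntegersIn L) (f : ℂ) :=
    Subring.subset_closure (Or.inr rfl)
  simpa [hf'] using Subring.mul_mem _ hinv hmul

/-- Finitely many elements of a number field lie in some `𝓞_L[1/f]` with `f` an integer. -/
theorem exists_int_subset_awayIn (L : Subfield ℂ) [FiniteDimensional ℚ L] {T : Set ℂ}
    (hT : T.Finite) (hTL : T ⊆ L) :
    ∃ f : ℤ, f ≠ 0 ∧ T ⊆ awayIn (ringOfIntegersIn L) (f : ℂ) := by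
  have hfin : ((↑) ⁻¹' T : Set L).Finite := hT.preimage Subtype.val_injective.injOn
  have : Algebra.IsAlgebraic ℤ L :=
    (IsFractionRing.comap_isAlgebraic_iff (A := ℤ) (K := ℚ) (C := L)).2 inferInstance
  obtain ⟨f, hf, hint⟩ := Algebra.IsAlgebraic.exists_integral_multiples ℤ hfin.toFinset
  refine ⟨f, hf, fun x hx => mem_awayIn_of_isIntegral_mul hf (hTL hx) ?_⟩
  simpa [zsmul_eq_mul] using
    (hint ⟨x, hTL hx⟩ (hfin.mem_toFinset.2 hx)).map L.subtype.toIntAlgHom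

/-- A nonzero finitely generated algebra over a field `k` admits a `k`-point over some finite
extension of `k` inside a given algebraically closed extension. -/
theorem exists_algHom_finiteDimensional_range {k Ω A : Type*} [Field k] [Field Ω] [Algebra k Ω]
    [IsAlgClosed Ω] [CommRing A] [Nontrivial A] [Algebra k A] [Algebra.FiniteType k A] :
    ∃ (ψ : A →ₐ[k] Ω) (L : IntermediateField k Ω), FiniteDimensional k L ∧ ∀ a, ψ a ∈ L := by
  obtain ⟨M, hM⟩ := Ideal.exists_maximal A
  let _ : Field (A ⧸ M) := Ideal.Quotient.field M
  have : Module.Finite k (A ⧸ M) := finite_of_finite_type_of_isJacobsonRing k (A ⧸ M)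
  let σ : (A ⧸ M) →ₐ[k] Ω := IsAlgClosed.lift
  exact ⟨σ.comp (Ideal.Quotient.mkₐ k M), σ.fieldRange,
    Module.Finite.equiv (AlgEquiv.ofInjectiveField σ).toLinearEquiv,
    fun a => ⟨Ideal.Quotient.mkₐ k M a, rfl⟩⟩

theorem Subgroup.finite_of_disjoint_finiteIndex {G : Type*} [Group G] {N H : Subgroup G}
    [H.FiniteIndex] (h : Disjoint N H) : Finite N := by
  refine Finite.of_injective (fun x : N => (x : G ⧸ H)) fun x y hxy => ?_
  have hH : (x : G)⁻¹ * y ∈ H := QuotientGroup.eq.1 hxy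
  have := Subgroup.disjoint_def.1 h (N.mul_mem (N.inv_mem x.2) y.2) hH
  exact Subtype.ext (inv_mul_eq_one.1 this)

/-- Proposition 4.3: if `Γ ≤ SL_m(ℂ)` is finitely generated and
`Γ ∩ SL_m(𝓞_{K,b})` has finite index in `Γ`, then there are a number field
`L ⊆ ℂ` containing `K`, a nonzero integer `f`, and a homomorphism
`Γ → SL_m(𝓞_{L,f})` with finite kernel. -/
theorem exists_hom_to_SL_ring_of_S_integers (m : ℕ) (hm : 2 ≤ m)
    (K : Subfield ℂ) (hK : FiniteDimensional ℚ K)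
    (b : ℂ) (hb : b ∈ ringOfIntegersIn K) (hb0 : b ≠ 0)
    (Γ : Subgroup (Matrix.SpecialLinearGroup (Fin m) ℂ)) (hfg : Group.FG Γ)
    (hidx : ((slOver m (awayIn (ringOfIntegersIn K) b)).subgroupOf Γ).FiniteIndex) :
    ∃ L : Subfield ℂ, K ≤ L ∧ FiniteDimensional ℚ L ∧
      ∃ f : ℤ, f ≠ 0 ∧
        ∃ φ : Γ →* Matrix.SpecialLinearGroup (Fin m) ℂ,
          φ.range ≤ slOver m (awayIn (ringOfIntegersIn L) ((f : ℤ) : ℂ)) ∧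
          Finite φ.ker := by
  obtain ⟨S, hS⟩ := Group.fg_def.1 hfg
  let E : Set ℂ := ⋃ g ∈ S, Set.range fun p : Fin m × Fin m =>
    (g : Matrix.SpecialLinearGroup (Fin m) ℂ) p.1 p.2
  have hE : E.Finite := S.finite_toSet.biUnion fun g _ => Set.finite_range _
  have hmemE : ∀ g ∈ S, ∀ i j, (g : Matrix.SpecialLinearGroup (Fin m) ℂ) i j ∈ E :=
    fun g hg i j => Set.mem_biUnion hg ⟨(i, j), rfl⟩
  let A : Subalgebra K ℂ := Algebra.adjoin K E
  have hEA : E ⊆ A := Algebra.subset_adjoin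
  have : Algebra.FiniteType K A :=
    A.fg_iff_finiteType.1 (Subalgebra.fg_def.2 ⟨E, hE, rfl⟩)
  have hΓA : ∀ γ : Γ, (γ : Matrix.SpecialLinearGroup (Fin m) ℂ) ∈ slOver m A.toSubring := by
    have hle : Subgroup.closure (S : Set Γ) ≤ (slOver m A.toSubring).comap Γ.subtype :=
      (Subgroup.closure_le _).2 fun g hg => mem_slOver_iff.2 fun i j => hEA (hmemE g hg i j)
    rw [hS] at hle
    exact fun γ => hle (Subgroup.mem_top γ)
  obtain ⟨ψ, L, hL, hψL⟩ := exists_algHom_finiteDimensional_range (k := K) (Ω := ℂ) (A := A)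
  have hinj : Function.Injective
      (Matrix.SpecialLinearGroup.map (n := Fin m) A.toSubring.subtype) := by
    intro g h hgh
    ext i j
    exact congrArg (fun x : Matrix.SpecialLinearGroup (Fin m) ℂ => x i j) hgh
  let ι : Γ →* Matrix.SpecialLinearGroup (Fin m) A.toSubring :=
    (MonoidHom.ofInjective hinj).symm.toMonoidHom.comp (Γ.subtype.codRestrict _ hΓA)
  have hι : ∀ (γ : Γ) i j, ((ι γ i j : A.toSubring) : ℂ) =
      (γ : Matrix.SpecialLinearGroup (Fin m) ℂ) i j := by
    intro γ i j
    have := MonoidHom.apply_ofInjective_symm hinj (Γ.subtype.codRestrict _ hΓA γ)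
    exact congrArg (fun x : Matrix.SpecialLinearGroup (Fin m) ℂ => x i j) this
  let ψ' : A.toSubring →+* ℂ := (ψ : A →+* ℂ)
  let φ : Γ →* Matrix.SpecialLinearGroup (Fin m) ℂ := (Matrix.SpecialLinearGroup.map ψ').comp ι
  have : FiniteDimensional K L := hL
  have : FiniteDimensional ℚ L.toSubfield := FiniteDimensional.trans ℚ K L
  obtain ⟨f, hf, hEf⟩ := exists_int_subset_awayIn L.toSubfield
    (T := ⋃ g ∈ S, Set.range fun p : Fin m × Fin m => φ g p.1 p.2)
    (S.finite_toSet.biUnion fun g _ => Set.finite_range _)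
    (Set.iUnion₂_subset fun g _ => Set.range_subset_iff.2 fun p => hψL _)
  refine ⟨L.toSubfield, fun x hx => L.algebraMap_mem ⟨x, hx⟩, inferInstance, f, hf, φ, ?_, ?_⟩
  · rw [MonoidHom.range_eq_map, ← hS, Subgroup.map_le_iff_le_comap, Subgroup.closure_le]
    exact fun g hg => mem_slOver_iff.2 fun i j => hEf (Set.mem_biUnion hg ⟨(i, j), rfl⟩)
  · refine Subgroup.finite_of_disjoint_finiteIndex
      (H := (slOver m (awayIn (ringOfIntegersIn K) b)).subgroupOf Γ)
      (Subgroup.disjoint_def.2 fun {γ} hker hγ => ?_)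
    have hφ : φ γ = γ := by
      ext i j
      have hK : (γ : Matrix.SpecialLinearGroup (Fin m) ℂ) i j ∈ K :=
        awayIn_ringOfIntegersIn_le hb (mem_slOver_iff.1 hγ i j)
      have hentry : ι γ i j = algebraMap K A ⟨_, hK⟩ := Subtype.ext (hι γ i j)
      change ψ (ι γ i j) = _
      rw [hentry, ψ.commutes]
      rfl
    exact Subtype.ext (hφ.symm.trans hker)
end
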